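/- arXiv:2312.15214 — 4 statements merged into one kernel-verified Lean document; each statement's English description precedes it below -/
import Mathlib

section
/- For every n ≥ 3, the set of natural numbers k for which there exist tuples s, s' ∈ ℤ^n with gcd(s_i,k) = 1 and gcd(s'_i,k) = 1 for all i, such that d_{Γ_{k,s}}(p,q) = d_{Γ_{k,s'}}(p,q) for all p,q ≥ 0 while Γ_{k,s} and Γ_{k,s'} are NOT conjugate in U(n), is infinite. (In other words, for each n ≥ 3 there are infinitely many pairs of (2n−1)-dimensional CR lens spaces that are CR isospectral but not equivalent.) -/
open MvPolynomial Matrix Complex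

noncomputable section

/-- The polynomial ring `ℂ[z_1,…,z_n, z̄_1,…,z̄_n]`. -/
abbrev Rn (n : ℕ) := MvPolynomial (Fin n ⊕ Fin n) ℂ

/-- Weight assigning `(1,0)` to each `z_j` and `(0,1)` to each `z̄_j`. -/
def wt (n : ℕ) : (Fin n ⊕ Fin n) → ℕ × ℕ := Sum.elim (fun _ => (1, 0)) (fun _ => (0, 1))

/-- `𝒫_{p,q}`: polynomials homogeneous of degree `p` in `z` and `q` in `z̄`. -/
def Ppq (n p q : ℕ) : Submodule ℂ (Rn n) :=
  MvPolynomial.weightedHomogeneousSubmodule ℂ (wt n) (p, q)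

/-- `Δ = Σ_j ∂²/∂z_j∂z̄_j`. -/
def DeltaOp (n : ℕ) : Rn n →ₗ[ℂ] Rn n :=
  ∑ j : Fin n, (MvPolynomial.pderiv (Sum.inl j)).toLinearMap ∘ₗ (MvPolynomial.pderiv (Sum.inr j)).toLinearMap

/-- `ℋ_{p,q}`: harmonic polynomials of bidegree `(p,q)`. -/
def Hpq (n p q : ℕ) : Submodule ℂ (Rn n) :=
  Ppq n p q ⊓ LinearMap.ker (DeltaOp n)

/-- The action of a matrix `γ` on `R_n` by the algebra substitution
`z_i ↦ Σ_j (γ⁻¹)_{ij} z_j`, `z̄_i ↦ Σ_j conj((γ⁻¹)_{ij}) z̄_j`. -/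
def matAct (n : ℕ) (γ : Matrix (Fin n) (Fin n) ℂ) : Rn n →ₐ[ℂ] Rn n :=
  MvPolynomial.aeval (Sum.elim
    (fun i => ∑ j, (γ⁻¹ i j) • MvPolynomial.X (Sum.inl j))
    (fun i => ∑ j, (starRingEnd ℂ) (γ⁻¹ i j) • MvPolynomial.X (Sum.inr j)))

/-- The subspace of polynomials fixed by the action of `γ`. -/
def fixedBy (n : ℕ) (γ : Matrix (Fin n) (Fin n) ℂ) : Submodule ℂ (Rn n) :=
  LinearMap.ker ((matAct n γ).toLinearMap - LinearMap.id)

/-- `ℋ_{p,q}^Γ`, the `Γ`-invariant harmonic polynomials of bidegree `(p,q)`. -/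
def HpqInv (n p q : ℕ) (Γ : Subgroup (Matrix.unitaryGroup (Fin n) ℂ)) : Submodule ℂ (Rn n) :=
  Hpq n p q ⊓ ⨅ γ ∈ Γ, fixedBy n ↑γ

/-- `d_Γ(p,q) = dim_ℂ ℋ_{p,q}^Γ`. -/
def dInv (n p q : ℕ) (Γ : Subgroup (Matrix.unitaryGroup (Fin n) ℂ)) : ℕ :=
  Module.finrank ℂ (HpqInv n p q Γ)

/-- A subgroup of `U(n)` acts freely on `S^{2n-1}` iff no nontrivial element has `1` as an
eigenvalue. -/
def actsFreely (n : ℕ) (Γ : Subgroup (Matrix.unitaryGroup (Fin n) ℂ)) : Prop :=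
  ∀ γ ∈ Γ, γ ≠ 1 → ∀ v : Fin n → ℂ, (↑γ : Matrix (Fin n) (Fin n) ℂ).mulVec v = v → v = 0
/-- The standard primitive `k`-th root of unity `ξ_k = exp(2πi/k)`. -/
def xi (k : ℕ) : ℂ := Complex.exp (2 * Real.pi * Complex.I / k)

lemma xi_ne_zero (k : ℕ) : xi k ≠ 0 := Complex.exp_ne_zero _

lemma star_xi (k : ℕ) : (starRingEnd ℂ) (xi k) = (xi k)⁻¹ := by
  rw [xi, ← Complex.exp_conj, ← Complex.exp_neg]
  congr 1
  rw [map_div₀, _root_.map_mul, _root_.map_mul, Complex.conj_I]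
  simp [Complex.conj_ofReal, map_ofNat]
  ring

/-- The generator `γ_{k,s} = diag(ξ_k^{s_1}, …, ξ_k^{s_n})` of a lens group. -/
def lensGen (n : ℕ) (k : ℕ) (s : Fin n → ℤ) : Matrix (Fin n) (Fin n) ℂ :=
  Matrix.diagonal fun i => xi k ^ (s i)

lemma lensGen_mem (n k : ℕ) (s : Fin n → ℤ) :
    lensGen n k s ∈ Matrix.unitaryGroup (Fin n) ℂ := by
  rw [Matrix.mem_unitaryGroup_iff]
  have hstar : star (lensGen n k s) = Matrix.diagonal fun i => star (xi k ^ (s i)) := by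
    rw [lensGen, Matrix.star_eq_conjTranspose, Matrix.diagonal_conjTranspose]
    rfl
  rw [hstar, lensGen, Matrix.diagonal_mul_diagonal]
  convert Matrix.diagonal_one
  rename_i i
  have : (starRingEnd ℂ) (xi k ^ (s i)) = (xi k ^ (s i))⁻¹ := by
    rw [map_zpow₀, star_xi, _root_.inv_zpow]
  rw [RCLike.star_def, this, mul_inv_cancel₀ (zpow_ne_zero _ (xi_ne_zero k))]

/-- The cyclic subgroup `Γ_{k,s}` of `U(n)` generated by `γ_{k,s}`. -/
def lensSubgroup (n k : ℕ) (s : Fin n → ℤ) : Subgroup (Matrix.unitaryGroup (Fin n) ℂ) :=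
  Subgroup.zpowers ⟨lensGen n k s, lensGen_mem n k s⟩

/-- Two subgroups of `U(n)` are conjugate in `U(n)`. -/
def ConjugateInU (n : ℕ) (Γ Γ' : Subgroup (Matrix.unitaryGroup (Fin n) ℂ)) : Prop :=
  ∃ A : Matrix.unitaryGroup (Fin n) ℂ, Subgroup.map (MulAut.conj A).toMonoidHom Γ = Γ'

/-- Exponents `(a, b)` of the monomials `z^a z̄^b` of bidegree `(p, q)` that are invariant under
`γ_{k,s}`. -/
def invExponents (n k : ℕ) (s : Fin n → ℤ) (p q : ℕ) : Set (Fin n ⊕ Fin n →₀ ℕ) :=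
  {d | (∑ i, d (Sum.inl i) = p ∧ ∑ i, d (Sum.inr i) = q) ∧
    (k : ℤ) ∣ ∑ i, s i * ((d (Sum.inl i) : ℤ) - d (Sum.inr i))}

/-- The exponent of `z_j z̄_j`. -/
def pairExponent {n : ℕ} (j : Fin n) : Fin n ⊕ Fin n →₀ ℕ :=
  Finsupp.single (Sum.inl j) 1 + Finsupp.single (Sum.inr j) 1

lemma pairExponent_inl {n : ℕ} (j i : Fin n) :
    pairExponent j (Sum.inl i) = if i = j then 1 else 0 := by
  simp [pairExponent, Finsupp.single_apply, eq_comm]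

lemma pairExponent_inr {n : ℕ} (j i : Fin n) :
    pairExponent j (Sum.inr i) = if i = j then 1 else 0 := by
  simp [pairExponent, Finsupp.single_apply, eq_comm]

lemma add_pairExponent_mem {n k : ℕ} {s : Fin n → ℤ} {p q : ℕ} {d : Fin n ⊕ Fin n →₀ ℕ}
    (j : Fin n) :
    d + pairExponent j ∈ invExponents n k s (p + 1) (q + 1) ↔ d ∈ invExponents n k s p q := by
  simp [invExponents, pairExponent_inl, pairExponent_inr, Finset.sum_add_distrib]

lemma sub_add_pairExponent {n : ℕ} {d : Fin n ⊕ Fin n →₀ ℕ} {j : Fin n}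
    (hl : d (Sum.inl j) ≠ 0) (hr : d (Sum.inr j) ≠ 0) :
    d - pairExponent j + pairExponent j = d := by
  apply tsub_add_cancel_of_le
  rintro (i | i)
  · rw [pairExponent_inl]; split_ifs with h
    · subst h; omega
    · omega
  · rw [pairExponent_inr]; split_ifs with h
    · subst h; omega
    · omega

lemma DeltaOp_monomial {n : ℕ} (d : Fin n ⊕ Fin n →₀ ℕ) :
    DeltaOp n (monomial d 1) =
      ∑ j, ((d (Sum.inl j) : ℂ) * d (Sum.inr j)) • monomial (d - pairExponent j) (1 : ℂ) := by
  simp only [DeltaOp, LinearMap.sum_apply, LinearMap.comp_apply]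
  refine Finset.sum_congr rfl fun j _ => ?_
  change pderiv (Sum.inl j) (pderiv (Sum.inr j) (monomial d 1)) = _
  rw [pderiv_monomial, pderiv_monomial, smul_monomial, pairExponent, add_comm, tsub_add_eq_tsub_tsub]
  congr 1
  simp [mul_comm]

lemma map_DeltaOp_restrictSupport {n k : ℕ} (hn : 0 < n) (s : Fin n → ℤ) (p q : ℕ) :
    (restrictSupport ℂ (invExponents n k s (p + 1) (q + 1))).map (DeltaOp n) =
      restrictSupport ℂ (invExponents n k s p q) := by
  apply le_antisymm
  · rw [restrictSupport_eq_span, Submodule.map_span_le]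
    rintro _ ⟨d, hd, rfl⟩
    simp only [DeltaOp_monomial]
    refine Submodule.sum_mem _ fun j _ => ?_
    by_cases hl : d (Sum.inl j) = 0
    · simp [hl]
    by_cases hr : d (Sum.inr j) = 0
    · simp [hr]
    refine Submodule.smul_mem _ _ ((monomial_mem_restrictSupport ℂ).2 (Or.inl ?_))
    rwa [← add_pairExponent_mem j, sub_add_pairExponent hl hr]
  · rw [restrictSupport_eq_span, Submodule.span_le]
    rintro _ ⟨d, hd, rfl⟩
    let j₀ : Fin n := ⟨0, hn⟩
    induction hN : ∑ j ∈ Finset.univ.erase j₀, d (Sum.inl j) using Nat.strong_induction_on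
      generalizing d with
    | _ N ih =>
      subst hN
      set e := d + pairExponent j₀ with he
      have hmem : e ∈ invExponents n k s (p + 1) (q + 1) := (add_pairExponent_mem j₀).2 hd
      have hΔ := DeltaOp_monomial e
      rw [← Finset.add_sum_erase _ _ (Finset.mem_univ j₀), he, add_tsub_cancel_right, ← he,
        ← sub_eq_iff_eq_add] at hΔ
      have hc : ((e (Sum.inl j₀) : ℂ) * e (Sum.inr j₀)) ≠ 0 := by
        simp [he, pairExponent_inl, pairExponent_inr, Nat.cast_add_one_ne_zero]
      refine (Submodule.smul_mem_iff _ hc).1 ?_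
      rw [← hΔ]
      refine Submodule.sub_mem _
        (Submodule.mem_map_of_mem ((monomial_mem_restrictSupport ℂ).2 (Or.inl hmem)))
        (Submodule.sum_mem _ fun j hj => ?_)
      by_cases hl : e (Sum.inl j) = 0
      · simp [hl]
      by_cases hr : e (Sum.inr j) = 0
      · simp [hr]
      have hjj := sub_add_pairExponent hl hr
      refine Submodule.smul_mem _ _ (ih _ ?_ _ ?_ rfl)
      · have hne := Finset.ne_of_mem_erase hj
        apply Finset.sum_lt_sum
        · intro i hi
          have := Finset.ne_of_mem_erase hi
          simp [he, pairExponent_inl, this]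
        · refine ⟨j, hj, ?_⟩
          simp [he, pairExponent_inl, hne] at hl ⊢
          omega
      · rwa [← add_pairExponent_mem j, hjj]

lemma restrictSupport_le_ker_DeltaOp {n k : ℕ} (s : Fin n → ℤ) {p q : ℕ} (h : p = 0 ∨ q = 0) :
    restrictSupport ℂ (invExponents n k s p q) ≤ LinearMap.ker (DeltaOp n) := by
  rw [restrictSupport_eq_span, Submodule.span_le]
  rintro _ ⟨d, ⟨⟨hp, hq⟩, -⟩, rfl⟩
  simp only [SetLike.mem_coe, LinearMap.mem_ker, DeltaOp_monomial]
  refine Finset.sum_eq_zero fun j _ => ?_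
  rcases h with rfl | rfl
  · simp [Finset.sum_eq_zero_iff.1 hp j (Finset.mem_univ j)]
  · simp [Finset.sum_eq_zero_iff.1 hq j (Finset.mem_univ j)]

lemma zpow_finset_sum {ι : Type*} {a : ℂ} (ha : a ≠ 0) (t : Finset ι) (f : ι → ℤ) :
    a ^ (∑ i ∈ t, f i) = ∏ i ∈ t, a ^ f i := by
  classical
  induction t using Finset.induction_on with
  | empty => simp
  | insert i t hi ih => rw [Finset.sum_insert hi, Finset.prod_insert hi, zpow_add₀ ha, ih]

lemma coe_zpow_lensGen {n k : ℕ} (s : Fin n → ℤ) (m : ℤ) :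
    (((⟨lensGen n k s, lensGen_mem n k s⟩ : Matrix.unitaryGroup (Fin n) ℂ) ^ m :
      Matrix.unitaryGroup (Fin n) ℂ) : Matrix (Fin n) (Fin n) ℂ) =
      Matrix.diagonal fun i => xi k ^ (m * s i) := by
  have hinv : (((⟨lensGen n k s, lensGen_mem n k s⟩ : Matrix.unitaryGroup (Fin n) ℂ)⁻¹ :
      Matrix.unitaryGroup (Fin n) ℂ) : Matrix (Fin n) (Fin n) ℂ) =
      Matrix.diagonal fun i => xi k ^ (- s i) := by
    change star (lensGen n k s) = _
    rw [lensGen, Matrix.star_eq_conjTranspose, Matrix.diagonal_conjTranspose]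
    congr 1
    funext i
    simp only [Pi.star_apply, RCLike.star_def]
    rw [map_zpow₀, star_xi, _root_.inv_zpow, _root_.zpow_neg]
  have hone : ((⟨lensGen n k s, lensGen_mem n k s⟩ : Matrix.unitaryGroup (Fin n) ℂ) :
      Matrix (Fin n) (Fin n) ℂ) = Matrix.diagonal fun i => xi k ^ s i := rfl
  induction m using Int.induction_on with
  | zero => simp
  | succ m ih =>
    rw [_root_.zpow_add_one, Matrix.UnitaryGroup.mul_val, ih, hone, Matrix.diagonal_mul_diagonal]
    congr 1
    funext i
    rw [← zpow_add₀ (xi_ne_zero k)]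
    congr 1
    ring
  | pred m ih =>
    rw [_root_.zpow_sub_one, Matrix.UnitaryGroup.mul_val, ih, hinv, Matrix.diagonal_mul_diagonal]
    congr 1
    funext i
    rw [← zpow_add₀ (xi_ne_zero k)]
    congr 1
    ring

lemma isPrimitiveRoot_xi {k : ℕ} (hk : k ≠ 0) : IsPrimitiveRoot (xi k) k :=
  Complex.isPrimitiveRoot_exp k hk

lemma coeff_matAct_diagonal {n k : ℕ} (t : Fin n → ℤ) (f : Rn n) (d : Fin n ⊕ Fin n →₀ ℕ) :
    coeff d (matAct n (Matrix.diagonal fun i => xi k ^ t i) f) =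
      xi k ^ (-∑ i, t i * ((d (Sum.inl i) : ℤ) - d (Sum.inr i))) * coeff d f := by
  have hinv : (Matrix.diagonal fun i => xi k ^ t i)⁻¹ =
      Matrix.diagonal fun i => xi k ^ (- t i) := by
    apply Matrix.inv_eq_right_inv
    rw [Matrix.diagonal_mul_diagonal]
    simp [zpow_ne_zero _ (xi_ne_zero k), _root_.zpow_neg]
  have hvar : matAct n (Matrix.diagonal fun i => xi k ^ t i) = aeval
      (fun v => Sum.elim (fun i => xi k ^ (- t i)) (fun i => xi k ^ (t i)) v • X v) := by
    rw [matAct, hinv]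
    congr 1
    funext v
    rcases v with i | i
    · simp [Matrix.diagonal_apply]
    · simp [Matrix.diagonal_apply, apply_ite, ite_smul, star_xi]
  rw [hvar]
  induction f using MvPolynomial.induction_on' with
  | monomial e c =>
    rw [aeval_monomial, Finsupp.prod_fintype _ _ (by simp), coeff_monomial]
    have hprod : ∏ v, (Sum.elim (fun i => xi k ^ (- t i)) (fun i => xi k ^ (t i)) v •
        (X v : Rn n)) ^ e v = C (xi k ^ (-∑ i, t i * ((e (Sum.inl i) : ℤ) - e (Sum.inr i)))) *
          monomial e 1 := by
      simp only [MvPolynomial.smul_eq_C_mul, mul_pow, Finset.prod_mul_distrib, ← C_pow]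
      rw [← map_prod, monomial_eq (s := e), C_1, one_mul, Finsupp.prod_fintype _ _ (by simp)]
      congr 2
      simp only [Fintype.prod_sum_type, Sum.elim_inl, Sum.elim_inr, ← zpow_natCast, ← _root_.zpow_mul]
      rw [← Finset.prod_mul_distrib, ← Finset.sum_neg_distrib, zpow_finset_sum (xi_ne_zero k)]
      refine Finset.prod_congr rfl fun i _ => ?_
      rw [← zpow_add₀ (xi_ne_zero k)]
      congr 1
      ring
    rw [hprod, MvPolynomial.algebraMap_eq, coeff_C_mul, coeff_C_mul, coeff_monomial]
    split_ifs with h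
    · rw [h]; ring
    · simp
  | add f g hf hg => rw [map_add, coeff_add, coeff_add, hf, hg, mul_add]

lemma HpqInv_eq {n k : ℕ} (hk : k ≠ 0) (s : Fin n → ℤ) (p q : ℕ) :
    HpqInv n p q (lensSubgroup n k s) =
      restrictSupport ℂ (invExponents n k s p q) ⊓ LinearMap.ker (DeltaOp n) := by
  have hfix : ∀ (m : ℤ) (f : Rn n), f ∈ fixedBy n (((⟨lensGen n k s, lensGen_mem n k s⟩ :
      Matrix.unitaryGroup (Fin n) ℂ) ^ m : Matrix.unitaryGroup (Fin n) ℂ)) ↔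
      ∀ d ∈ f.support, (k : ℤ) ∣ m * ∑ i, s i * ((d (Sum.inl i) : ℤ) - d (Sum.inr i)) := by
    intro m f
    rw [coe_zpow_lensGen, fixedBy, LinearMap.mem_ker, LinearMap.sub_apply, sub_eq_zero,
      MvPolynomial.ext_iff]
    refine forall_congr' fun d => ?_
    change coeff d (matAct n _ f) = coeff d f ↔ _
    rw [coeff_matAct_diagonal, mem_support_iff]
    by_cases h0 : coeff d f = 0
    · simp [h0]
    · simp only [mul_eq_right₀ h0, ne_eq, h0, not_false_eq_true, forall_const,
        (isPrimitiveRoot_xi hk).zpow_eq_one_iff_dvd, dvd_neg, mul_assoc, Finset.mul_sum]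
  have hP : ∀ f : Rn n, f ∈ Ppq n p q ↔
      ∀ d ∈ f.support, ∑ i, d (Sum.inl i) = p ∧ ∑ i, d (Sum.inr i) = q := by
    intro f
    rw [Ppq, mem_weightedHomogeneousSubmodule]
    refine forall_congr' fun d => ?_
    rw [mem_support_iff, Finsupp.weight_apply, Finsupp.sum_fintype _ _ (by simp)]
    simp [wt, Prod.ext_iff, Prod.fst_sum, Prod.snd_sum, -nsmul_eq_mul]
  ext f
  simp only [HpqInv, Hpq, lensSubgroup, Submodule.mem_inf, Submodule.mem_iInf,
    mem_restrictSupport_iff, hP]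
  constructor
  · rintro ⟨⟨h1, h2⟩, h3⟩
    refine ⟨fun d hd => ⟨h1 d hd, ?_⟩, h2⟩
    simpa using (hfix 1 f).1 (h3 _ (Subgroup.zpow_mem_zpowers _ 1)) d hd
  · rintro ⟨h1, h2⟩
    refine ⟨⟨fun d hd => (h1 hd).1, h2⟩, ?_⟩
    rintro _ ⟨m, rfl⟩
    exact (hfix m f).2 fun d hd => Dvd.dvd.mul_left (h1 hd).2 m

lemma finrank_restrictSupport {σ : Type*} (S : Set (σ →₀ ℕ)) :
    Module.finrank ℂ (restrictSupport ℂ S) = S.ncard := by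
  rw [Module.finrank_eq_nat_card_basis (basisRestrictSupport ℂ S), Nat.card_coe_set_eq]

lemma finite_invExponents (n k : ℕ) (s : Fin n → ℤ) (p q : ℕ) :
    (invExponents n k s p q).Finite := by
  refine (Finset.finite_toSet (Finset.finsuppAntidiag Finset.univ (p + q))).subset ?_
  rintro d ⟨⟨hp, hq⟩, -⟩
  simp [hp, hq]

lemma dInv_zero {n k : ℕ} (hk : k ≠ 0) (s : Fin n → ℤ) {p q : ℕ} (h : p = 0 ∨ q = 0) :
    dInv n p q (lensSubgroup n k s) = (invExponents n k s p q).ncard := by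
  rw [dInv, HpqInv_eq hk, inf_eq_left.2 (restrictSupport_le_ker_DeltaOp s h),
    finrank_restrictSupport]

lemma dInv_succ {n k : ℕ} (hn : 0 < n) (hk : k ≠ 0) (s : Fin n → ℤ) (p q : ℕ) :
    (invExponents n k s p q).ncard + dInv n (p + 1) (q + 1) (lensSubgroup n k s) =
      (invExponents n k s (p + 1) (q + 1)).ncard := by
  have := (finite_invExponents n k s (p + 1) (q + 1)).to_subtype
  have := Module.Finite.of_basis
    (basisRestrictSupport ℂ (invExponents n k s (p + 1) (q + 1)))
  rw [dInv, HpqInv_eq hk, ← finrank_restrictSupport, ← finrank_restrictSupport,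
    ← map_DeltaOp_restrictSupport hn, ← Submodule.map_comap_subtype,
    Submodule.finrank_map_subtype_eq, ← LinearMap.ker_domRestrict, ← LinearMap.range_domRestrict]
  exact LinearMap.finrank_range_add_finrank_ker _

lemma dInv_eq_of_ncard_eq {n k : ℕ} (hn : 0 < n) (hk : k ≠ 0) (s s' : Fin n → ℤ)
    (h : ∀ p q, (invExponents n k s p q).ncard = (invExponents n k s' p q).ncard) (p q : ℕ) :
    dInv n p q (lensSubgroup n k s) = dInv n p q (lensSubgroup n k s') := by
  rcases p with _ | p
  · rw [dInv_zero hk s (Or.inl rfl), dInv_zero hk s' (Or.inl rfl), h]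
  rcases q with _ | q
  · rw [dInv_zero hk s (Or.inr rfl), dInv_zero hk s' (Or.inr rfl), h]
  have h1 := dInv_succ hn hk s p q
  have h2 := dInv_succ hn hk s' p q
  rw [h, h] at h1
  omega

/-- The generating series `∏_i 1 / (1 - x_i t)` of the complete homogeneous symmetric polynomials
evaluated at `x`. -/
def hSeries {n : ℕ} (x : Fin n → ℂ) : PowerSeries ℂ :=
  ∏ i, PowerSeries.mk fun m => x i ^ m

lemma coeff_hSeries {n : ℕ} (x : Fin n → ℂ) (p : ℕ) :
    PowerSeries.coeff p (hSeries x) =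
      ∑ a ∈ Finset.finsuppAntidiag Finset.univ p, ∏ i, x i ^ a i := by
  simp [hSeries, PowerSeries.coeff_prod]

lemma coeff_hSeries_mul {n : ℕ} (c : ℂ) (x : Fin n → ℂ) (p : ℕ) :
    PowerSeries.coeff p (hSeries fun i => c * x i) = c ^ p * PowerSeries.coeff p (hSeries x) := by
  rw [coeff_hSeries, coeff_hSeries, Finset.mul_sum]
  refine Finset.sum_congr rfl fun a ha => ?_
  rw [← (Finset.mem_finsuppAntidiag.1 ha).1]
  simp [mul_pow, Finset.prod_mul_distrib, Finset.prod_pow_eq_pow_sum]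

lemma exists_mul_prod_one_sub {n r : ℕ} (hn : 0 < n) (hr : 0 < r) {x : Fin n → ℂ}
    (hx : Function.Injective x) (hxr : ∀ i, x i ^ r = 1) :
    ∃ G : Polynomial ℂ, G.natDegree < r ∧
      G * ∏ i, (1 - Polynomial.C (x i) * Polynomial.X) = 1 - Polynomial.X ^ r := by
  classical
  have hprim : IsPrimitiveRoot (Polynomial.C (xi r)) r :=
    (isPrimitiveRoot_xi hr.ne').map_of_injective Polynomial.C_injective
  have hfac := hprim.pow_sub_pow_eq_prod_sub_mul (1 : Polynomial ℂ) Polynomial.X hr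
  have hinj : Function.Injective fun i => Polynomial.C (x i) := Polynomial.C_injective.comp hx
  have hdvd : ∏ i, (1 - Polynomial.C (x i) * Polynomial.X) ∣ 1 - (Polynomial.X : Polynomial ℂ) ^ r := by
    rw [one_pow] at hfac
    rw [hfac, ← Finset.prod_image (s := Finset.univ) (g := fun i => Polynomial.C (x i))
      (f := fun y => 1 - y * Polynomial.X) hinj.injOn]
    apply Finset.prod_dvd_prod_of_subset
    intro y hy
    obtain ⟨i, -, rfl⟩ := Finset.mem_image.1 hy
    rw [Polynomial.mem_nthRootsFinset hr, ← Polynomial.C_pow, hxr, Polynomial.C_1]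
  obtain ⟨G, hG⟩ := hdvd
  refine ⟨G, ?_, by rw [hG, mul_comm]⟩
  have hx0 : ∀ i, x i ≠ 0 := fun i h => by simpa [h, hr.ne'] using hxr i
  have hdeg1 : ∀ i, (1 - Polynomial.C (x i) * Polynomial.X).natDegree = 1 := fun i => by
    rw [Polynomial.natDegree_sub_eq_right_of_natDegree_lt] <;>
      simp [Polynomial.natDegree_C_mul_X _ (hx0 i)]
  have hne : ∀ i, (1 - Polynomial.C (x i) * Polynomial.X) ≠ 0 := fun i h => by
    simpa [h] using hdeg1 i
  have hdegr : (1 - (Polynomial.X : Polynomial ℂ) ^ r).natDegree = r := by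
    rw [Polynomial.natDegree_sub_eq_right_of_natDegree_lt] <;> simp [hr]
  have hG0 : G ≠ 0 := by
    rintro rfl
    rw [hG, mul_zero, Polynomial.natDegree_zero] at hdegr
    omega
  rw [hG, Polynomial.natDegree_mul (Finset.prod_ne_zero_iff.2 fun i _ => hne i) hG0,
    Polynomial.natDegree_prod _ _ fun i _ => hne i] at hdegr
  simp only [hdeg1, Finset.sum_const, Finset.card_univ, Fintype.card_fin, smul_eq_mul] at hdegr
  omega

lemma hSeries_mul_prod_one_sub {n : ℕ} (x : Fin n → ℂ) :
    hSeries x * ∏ i, (1 - PowerSeries.C (x i) * PowerSeries.X) = 1 := by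
  rw [hSeries, ← Finset.prod_mul_distrib]
  refine Finset.prod_eq_one fun i _ => ?_
  ext m
  rcases m with _ | m
  · simp
  · rw [mul_sub, mul_one, map_sub, mul_left_comm, PowerSeries.coeff_C_mul,
      PowerSeries.coeff_succ_mul_X]
    simp [PowerSeries.coeff_one, pow_succ']

lemma periodic_coeff_hSeries {n r : ℕ} (hn : 0 < n) (hr : 0 < r) {x : Fin n → ℂ}
    (hx : Function.Injective x) (hxr : ∀ i, x i ^ r = 1) :
    Function.Periodic (fun p => PowerSeries.coeff p (hSeries x)) r := by
  intro p
  obtain ⟨G, hdeg, hG⟩ := exists_mul_prod_one_sub hn hr hx hxr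
  have hG' : (G : PowerSeries ℂ) * ∏ i, (1 - PowerSeries.C (x i) * PowerSeries.X) =
      1 - PowerSeries.X ^ r := by
    have hcoe : ((∏ i, (1 - Polynomial.C (x i) * Polynomial.X) : Polynomial ℂ) : PowerSeries ℂ) =
        ∏ i, (1 - PowerSeries.C (x i) * PowerSeries.X) := by
      rw [← Polynomial.coeToPowerSeries.ringHom_apply, map_prod]
      simp
    rw [← hcoe, ← Polynomial.coe_mul, hG]
    simp
  have key : (G : PowerSeries ℂ) = hSeries x - hSeries x * PowerSeries.X ^ r := by
    rw [← mul_one_sub, ← hG', mul_left_comm, hSeries_mul_prod_one_sub, mul_one]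
  have := congrArg (PowerSeries.coeff (p + r)) key
  rw [Polynomial.coeff_coe, Polynomial.coeff_eq_zero_of_natDegree_lt (by omega), map_sub,
    PowerSeries.coeff_mul_X_pow] at this
  exact (sub_eq_zero.1 this.symm)

lemma coeff_hSeries_congr {n r : ℕ} (hn : 0 < n) (hr : 0 < r) {x : Fin n → ℂ}
    (hx : Function.Injective x) (hxr : ∀ i, x i ^ r = 1) {p q : ℕ} (h : p ≡ q [MOD r]) :
    PowerSeries.coeff p (hSeries x) = PowerSeries.coeff q (hSeries x) := by
  have hper := periodic_coeff_hSeries hn hr hx hxr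
  have h1 := hper.map_mod_nat p
  have h2 := hper.map_mod_nat q
  rw [h] at h1
  exact h1.symm.trans h2

lemma xi_zpow_pow {k : ℕ} (hk : k ≠ 0) (m : ℤ) : (xi k ^ m) ^ k = 1 := by
  rw [← zpow_natCast, ← _root_.zpow_mul, mul_comm, _root_.zpow_mul, zpow_natCast,
    (isPrimitiveRoot_xi hk).pow_eq_one, _root_.one_zpow]

lemma sum_range_xi_zpow {k : ℕ} (hk : k ≠ 0) (m : ℤ) :
    ∑ j ∈ Finset.range k, xi k ^ ((j : ℤ) * m) = if (k : ℤ) ∣ m then (k : ℂ) else 0 := by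
  have hpow : ∀ j : ℕ, xi k ^ ((j : ℤ) * m) = (xi k ^ m) ^ j := fun j => by
    rw [mul_comm, _root_.zpow_mul, zpow_natCast]
  simp only [hpow]
  have hiff := (isPrimitiveRoot_xi hk).zpow_eq_one_iff_dvd m
  split_ifs with h
  · simp [hiff.2 h]
  · have hne : xi k ^ m ≠ 1 := fun h' => h (hiff.1 h')
    rw [geom_sum_eq hne, xi_zpow_pow hk, sub_self, zero_div]

lemma ncard_invExponents (n k : ℕ) (s : Fin n → ℤ) (p q : ℕ) :
    (invExponents n k s p q).ncard =
      (((Finset.finsuppAntidiag (Finset.univ : Finset (Fin n)) p) ×ˢ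
        (Finset.finsuppAntidiag (Finset.univ : Finset (Fin n)) q)).filter
        fun ab => (k : ℤ) ∣ ∑ i, s i * ((ab.1 i : ℤ) - ab.2 i)).card := by
  rw [← Finset.card_map Finsupp.sumFinsuppEquivProdFinsupp.symm.toEmbedding,
    ← Set.ncard_coe_finset]
  congr 1
  ext d
  rw [Finset.mem_coe, Finset.mem_map_equiv, Equiv.symm_symm]
  simp only [invExponents, Set.mem_ofPred_eq, Finset.mem_filter, Finset.mem_product,
    Finset.mem_finsuppAntidiag, Finset.subset_univ, and_true,
    Finsupp.fst_sumFinsuppEquivProdFinsupp, Finsupp.snd_sumFinsuppEquivProdFinsupp]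
  rfl

lemma natCast_mul_ncard_invExponents {n k : ℕ} (hk : k ≠ 0) (s : Fin n → ℤ) (p q : ℕ) :
    (k : ℂ) * (invExponents n k s p q).ncard = ∑ j ∈ Finset.range k,
      PowerSeries.coeff p (hSeries fun i => xi k ^ ((j : ℤ) * s i)) *
        PowerSeries.coeff q (hSeries fun i => xi k ^ (-((j : ℤ) * s i))) := by
  have hterm : ∀ (j : ℕ) (a b : Fin n →₀ ℕ),
      (∏ i, (xi k ^ ((j : ℤ) * s i)) ^ a i) * ∏ i, (xi k ^ (-((j : ℤ) * s i))) ^ b i =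
        xi k ^ ((j : ℤ) * ∑ i, s i * ((a i : ℤ) - b i)) := by
    intro j a b
    rw [← Finset.prod_mul_distrib, Finset.mul_sum, zpow_finset_sum (xi_ne_zero k)]
    refine Finset.prod_congr rfl fun i _ => ?_
    rw [← zpow_natCast, ← zpow_natCast, ← _root_.zpow_mul, ← _root_.zpow_mul,
      ← zpow_add₀ (xi_ne_zero k)]
    congr 1
    ring
  simp only [coeff_hSeries, Finset.sum_mul_sum, hterm]
  rw [ncard_invExponents, mul_comm, ← nsmul_eq_mul, ← Finset.sum_const, Finset.sum_filter,
    Finset.sum_product]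
  simp only [← sum_range_xi_zpow hk]
  rw [Finset.sum_comm_cycle]

lemma coeff_hSeries_mul_coeff_hSeries_inv {n r : ℕ} (hn : 0 < n) (hr : r.Prime) {θ : Fin n → ℤ}
    (hθ : ∀ i j, (r : ℤ) ∣ θ i - θ j → i = j) {p q : ℕ} (hpq : p ≡ q [MOD r]) (j : ℤ) :
    PowerSeries.coeff p (hSeries fun i => xi r ^ (j * θ i)) *
        PowerSeries.coeff q (hSeries fun i => xi r ^ (-(j * θ i))) =
      PowerSeries.coeff p (hSeries fun i => xi r ^ (-(j * θ i))) *
        PowerSeries.coeff q (hSeries fun i => xi r ^ (j * θ i)) := by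
  have hprim := isPrimitiveRoot_xi hr.ne_zero
  by_cases hj : (r : ℤ) ∣ j
  · have h1 : ∀ i, xi r ^ (j * θ i) = 1 := fun i =>
      (hprim.zpow_eq_one_iff_dvd _).2 (hj.mul_right _)
    simp only [_root_.zpow_neg, h1, inv_one]
  · have hinj : Function.Injective fun i => xi r ^ (j * θ i) := by
      intro a b hab
      have h1 : xi r ^ (j * (θ a - θ b)) = 1 := by
        rw [mul_sub, zpow_sub₀ (xi_ne_zero r)]
        exact div_eq_one_iff_eq (zpow_ne_zero _ (xi_ne_zero r)) |>.2 hab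
      exact hθ a b (((Nat.prime_iff_prime_int.1 hr).dvd_or_dvd
        ((hprim.zpow_eq_one_iff_dvd _).1 h1)).resolve_left hj)
    have hinj' : Function.Injective fun i => xi r ^ (-(j * θ i)) := by
      intro a b hab
      simp only [_root_.zpow_neg, _root_.inv_inj] at hab
      exact hinj hab
    rw [coeff_hSeries_congr hn hr.pos hinj (fun i => xi_zpow_pow hr.ne_zero _) hpq,
      coeff_hSeries_congr hn hr.pos hinj' (fun i => xi_zpow_pow hr.ne_zero _) hpq, mul_comm]

lemma xi_sq_zpow_mul {r : ℕ} (hr : r ≠ 0) (m : ℤ) : xi (r ^ 2) ^ (r * m) = xi r ^ m := by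
  rw [_root_.zpow_mul, zpow_natCast, xi, xi, ← Complex.exp_nat_mul]
  congr 2
  have : (r : ℂ) ≠ 0 := Nat.cast_ne_zero.2 hr
  push_cast
  field_simp

lemma modEq_of_mem_invExponents {n r : ℕ} {θ : Fin n → ℤ} {p q : ℕ} {d : Fin n ⊕ Fin n →₀ ℕ}
    (hd : d ∈ invExponents n (r ^ 2) (fun i => 1 + r * θ i) p q) : p ≡ q [MOD r] := by
  obtain ⟨⟨hp, hq⟩, hdvd⟩ := hd
  have hsum : ∑ i, (1 + r * θ i) * ((d (Sum.inl i) : ℤ) - d (Sum.inr i)) =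
      (p : ℤ) - q + r * ∑ i, θ i * ((d (Sum.inl i) : ℤ) - d (Sum.inr i)) := by
    rw [← hp, ← hq, Finset.mul_sum]
    push_cast
    rw [← Finset.sum_sub_distrib, ← Finset.sum_add_distrib]
    exact Finset.sum_congr rfl fun i _ => by ring
  rw [hsum] at hdvd
  have h1 : (r : ℤ) ∣ (p : ℤ) - q := by
    rw [← dvd_add_left (Dvd.intro _ rfl)]
    refine dvd_trans ?_ hdvd
    exact_mod_cast dvd_pow_self r two_ne_zero
  exact ((Nat.modEq_iff_dvd).2 h1).symm

lemma ncard_invExponents_neg {n r : ℕ} (hn : 0 < n) (hr : r.Prime) {θ : Fin n → ℤ}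
    (hθ : ∀ i j, (r : ℤ) ∣ θ i - θ j → i = j) (p q : ℕ) :
    (invExponents n (r ^ 2) (fun i => 1 + r * θ i) p q).ncard =
      (invExponents n (r ^ 2) (fun i => 1 + r * -θ i) p q).ncard := by
  by_cases hpq : p ≡ q [MOD r]
  · have hk : r ^ 2 ≠ 0 := pow_ne_zero _ hr.ne_zero
    have hkC : ((r ^ 2 : ℕ) : ℂ) ≠ 0 := Nat.cast_ne_zero.2 hk
    have hsplit : ∀ (j : ℕ) (t : ℤ), xi (r ^ 2) ^ ((j : ℤ) * (1 + r * t)) =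
        xi (r ^ 2) ^ (j : ℤ) * xi r ^ (j * t) := fun j t => by
      rw [← xi_sq_zpow_mul hr.ne_zero, ← zpow_add₀ (xi_ne_zero _)]
      congr 1
      ring
    have hsplit' : ∀ (j : ℕ) (t : ℤ), xi (r ^ 2) ^ (-((j : ℤ) * (1 + r * t))) =
        xi (r ^ 2) ^ (-(j : ℤ)) * xi r ^ (-(j * t)) := fun j t => by
      rw [← xi_sq_zpow_mul hr.ne_zero, ← zpow_add₀ (xi_ne_zero _)]
      congr 1
      ring
    rw [← Nat.cast_inj (R := ℂ), ← mul_right_inj' hkC, natCast_mul_ncard_invExponents hk,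
      natCast_mul_ncard_invExponents hk]
    refine Finset.sum_congr rfl fun j _ => ?_
    simp only [hsplit, hsplit', coeff_hSeries_mul]
    simp only [mul_neg, neg_neg]
    rw [mul_mul_mul_comm, coeff_hSeries_mul_coeff_hSeries_inv hn hr hθ hpq, mul_mul_mul_comm]
  · have hempty : ∀ t : Fin n → ℤ, invExponents n (r ^ 2) (fun i => 1 + r * t i) p q = ∅ :=
      fun t => Set.eq_empty_of_forall_notMem fun d hd => hpq (modEq_of_mem_invExponents hd)
    rw [hempty, hempty fun i => -θ i]

lemma exists_dvd_of_conjugateInU {n k : ℕ} (hk : k ≠ 0) {s s' : Fin n → ℤ}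
    (h : ConjugateInU n (lensSubgroup n k s) (lensSubgroup n k s')) :
    ∃ m : ℤ, ∀ i, ∃ j, (k : ℤ) ∣ s i - m * s' j := by
  obtain ⟨A, hA⟩ := h
  have hmem : A * ⟨lensGen n k s, lensGen_mem n k s⟩ * A⁻¹ ∈ lensSubgroup n k s' := by
    rw [← hA]
    exact ⟨_, Subgroup.mem_zpowers _, rfl⟩
  obtain ⟨m, hm⟩ := hmem
  refine ⟨m, fun i => ?_⟩
  have hm' := congrArg (Subtype.val) (eq_mul_inv_iff_mul_eq.1 hm)
  rw [Matrix.UnitaryGroup.mul_val, Matrix.UnitaryGroup.mul_val, coe_zpow_lensGen] at hm'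
  obtain ⟨j, hj⟩ : ∃ j, (A : Matrix (Fin n) (Fin n) ℂ) j i ≠ 0 := by
    by_contra! h0
    have h1 := congrFun (congrFun (Matrix.mem_unitaryGroup_iff'.1 A.2) i) i
    rw [Matrix.mul_apply] at h1
    simp [h0] at h1
  refine ⟨j, ?_⟩
  have hji := congrFun (congrFun hm' j) i
  simp only [lensGen, Matrix.diagonal_mul, Matrix.mul_diagonal] at hji
  rw [mul_comm, mul_right_inj' hj] at hji
  rw [← (isPrimitiveRoot_xi hk).zpow_eq_one_iff_dvd, zpow_sub₀ (xi_ne_zero k), hji,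
    div_self (zpow_ne_zero _ (xi_ne_zero k))]

lemma exists_dvd_add_sub {n r : ℕ} (hn : 0 < n) (hr : r ≠ 0) {θ : Fin n → ℤ}
    (h : ConjugateInU n (lensSubgroup n (r ^ 2) fun i => 1 + r * θ i)
      (lensSubgroup n (r ^ 2) fun i => 1 + r * -θ i)) :
    ∃ c : ℤ, ∀ i, ∃ j, (r : ℤ) ∣ θ i + θ j - c := by
  obtain ⟨m, hm⟩ := exists_dvd_of_conjugateInU (pow_ne_zero 2 hr) h
  have hr' : (r : ℤ) ≠ 0 := Int.natCast_ne_zero.2 hr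
  push_cast at hm
  obtain ⟨c, hc⟩ : (r : ℤ) ∣ m - 1 := by
    obtain ⟨j, t, ht⟩ := hm ⟨0, hn⟩
    exact ⟨θ ⟨0, hn⟩ + m * θ j - r * t, by linear_combination -ht⟩
  obtain rfl : m = 1 + r * c := by linear_combination hc
  refine ⟨c, fun i => ?_⟩
  obtain ⟨j, t, ht⟩ := hm i
  refine ⟨j, t - c * θ j, mul_left_cancel₀ hr' ?_⟩
  linear_combination ht

/-- The exponents `0, 1, …, n - 2, n`. -/
def gapExponent (n : ℕ) (i : Fin n) : ℤ := if (i : ℕ) + 1 = n then n else i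

lemma gapExponent_nonneg (n : ℕ) (i : Fin n) : 0 ≤ gapExponent n i := by
  unfold gapExponent; split_ifs <;> omega

lemma gapExponent_le (n : ℕ) (i : Fin n) : gapExponent n i ≤ n := by
  unfold gapExponent; split_ifs <;> omega

lemma gapExponent_injective (n : ℕ) : Function.Injective (gapExponent n) := by
  intro i j h
  unfold gapExponent at h
  ext
  split_ifs at h <;> omega

lemma eq_of_dvd_sub_of_lt {r a b B : ℤ} (ha : 0 ≤ a) (haB : a ≤ B) (hb : 0 ≤ b) (hbB : b ≤ B)
    (hB : B < r) (h : r ∣ a - b) : a = b := by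
  rw [← sub_eq_zero]
  exact Int.eq_zero_of_abs_lt_dvd h (by rw [abs_lt]; constructor <;> linarith)

lemma not_conjugateInU_gapExponent {n r : ℕ} (hn : 3 ≤ n) (hr : 2 * n < r) :
    ¬ ConjugateInU n (lensSubgroup n (r ^ 2) fun i => 1 + r * gapExponent n i)
      (lensSubgroup n (r ^ 2) fun i => 1 + r * -gapExponent n i) := by
  intro h
  obtain ⟨c, hc⟩ := exists_dvd_add_sub (by omega) (by omega) h
  choose σ hσ using hc
  have heq : ∀ i j, gapExponent n i + gapExponent n (σ i) =
      gapExponent n j + gapExponent n (σ j) := fun i j => by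
    have h1 := gapExponent_nonneg n
    have h2 := gapExponent_le n
    refine eq_of_dvd_sub_of_lt (r := r) (B := 2 * n) (by linarith [h1 i, h1 (σ i)])
      (by linarith [h2 i, h2 (σ i)]) (by linarith [h1 j, h1 (σ j)])
      (by linarith [h2 j, h2 (σ j)]) (by exact_mod_cast hr) ?_
    simpa only [sub_sub_sub_cancel_right] using dvd_sub (hσ i) (hσ j)
  have h0 := heq ⟨0, by omega⟩ ⟨1, by omega⟩
  have hlast := heq ⟨n - 1, by omega⟩ ⟨1, by omega⟩
  unfold gapExponent at h0 hlast
  simp only at h0 hlast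
  split_ifs at h0 hlast <;> omega

/-- **Infinitely many CR isospectral non-equivalent pairs in every dimension `2n-1`, `n ≥ 3`.**
For each `n ≥ 3` there are infinitely many orders `k` admitting tuples `s, s'` whose lens
groups have equal invariant dimensions `d(p,q)` (CR isospectrality) but are not conjugate
in `U(n)` (non-equivalence of the CR lens spaces). -/
theorem infinitely_many_isospectral_nonequivalent_pairs (n : ℕ) (hn : 3 ≤ n) :
    {k : ℕ | ∃ s s' : Fin n → ℤ,
      (∀ i, Int.gcd (s i) k = 1) ∧ (∀ i, Int.gcd (s' i) k = 1) ∧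
      (∀ p q : ℕ, dInv n p q (lensSubgroup n k s) = dInv n p q (lensSubgroup n k s')) ∧
      ¬ ConjugateInU n (lensSubgroup n k s) (lensSubgroup n k s')}.Infinite := by
  refine Set.infinite_of_not_bddAbove ?_
  rintro ⟨N, hN⟩
  obtain ⟨r, hrN, hr⟩ := Nat.exists_infinite_primes (N + 2 * n + 1)
  have hn0 : 0 < n := by omega
  have hcop : ∀ t : ℤ, Int.gcd (1 + r * t) (r ^ 2 : ℕ) = 1 := fun t => by
    rw [← Int.isCoprime_iff_gcd_eq_one]
    push_cast
    exact IsCoprime.pow_right ⟨1, -t, by ring⟩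
  have hθ : ∀ i j, (r : ℤ) ∣ gapExponent n i - gapExponent n j → i = j := fun i j h =>
    gapExponent_injective n (eq_of_dvd_sub_of_lt (gapExponent_nonneg n i) (gapExponent_le n i)
      (gapExponent_nonneg n j) (gapExponent_le n j) (by omega) h)
  have hle : r ^ 2 ≤ N := hN ⟨fun i => 1 + r * gapExponent n i, fun i => 1 + r * -gapExponent n i,
    fun i => hcop _, fun i => hcop _,
    dInv_eq_of_ncard_eq hn0 (pow_ne_zero 2 hr.ne_zero) _ _ (ncard_invExponents_neg hn0 hr hθ),
    not_conjugateInU_gapExponent hn (by omega)⟩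
  nlinarith [hr.pos]

end
end

section
/- Let d ≥ 1 and let Γ and Γ' be finite subgroups of U(d) acting freely on S^{2d−1}. Suppose Γ and Γ' are almost conjugate in U(d), i.e., there exists a bijection τ : Γ → Γ' such that for every γ ∈ Γ there exists A ∈ U(d) with τ(γ) = A·γ·A⁻¹. Then d_Γ(p,q) = d_{Γ'}(p,q) for all p, q ≥ 0; consequently the elliptic CR manifolds S^{2d−1}/Γ and S^{2d−1}/Γ' are CR isospectral. -/
open MvPolynomial Matrix Complex

noncomputable section

theorem MvPolynomial.IsWeightedHomogeneous.aeval {σ τ R M : Type*} [CommSemiring R]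
    [AddCommMonoid M] {w : σ → M} {v : τ → M} {f : σ → MvPolynomial τ R}
    (hf : ∀ i, IsWeightedHomogeneous v (f i) (w i)) {P : MvPolynomial σ R} {m : M}
    (hP : IsWeightedHomogeneous w P m) :
    IsWeightedHomogeneous v (MvPolynomial.aeval f P) m := by
  induction hP using IsWeightedHomogeneous.induction_on with
  | zero => simpa using isWeightedHomogeneous_zero R v m
  | add P Q _ _ hP hQ => simpa using hP.add hQ
  | monomial e r he =>
    rw [aeval_monomial, algebraMap_eq, ← he, Finsupp.weight_apply]
    exact (IsWeightedHomogeneous.prod _ _ _ fun i _ => (hf i).pow (e i)).C_mul r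

theorem MvPolynomial.pderiv_aeval {σ τ R : Type*} [CommSemiring R] [Fintype σ]
    (f : σ → MvPolynomial τ R) (j : τ) (P : MvPolynomial σ R) :
    pderiv j (MvPolynomial.aeval f P) =
      ∑ i, pderiv j (f i) * MvPolynomial.aeval f (pderiv i P) := by
  classical
  induction P using MvPolynomial.induction_on with
  | C a => simp [algebraMap_eq]
  | add P Q hP hQ => simp only [map_add, hP, hQ, mul_add, Finset.sum_add_distrib]
  | mul_X P k hP =>
    simp only [map_mul, Derivation.leibniz, aeval_X, hP, smul_eq_mul, map_add, mul_add,
      Finset.sum_add_distrib, pderiv_X, Pi.single_apply, Finset.mul_sum]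
    congr 1
    · simp [apply_ite, mul_comm]
    · exact Finset.sum_congr rfl fun i _ => by ring

variable {n p q : ℕ}

theorem matAct_X_inl (γ : Matrix (Fin n) (Fin n) ℂ) (i : Fin n) :
    matAct n γ (X (Sum.inl i)) = ∑ j, (γ⁻¹ i j) • X (Sum.inl j) := by
  simp [matAct]

theorem matAct_X_inr (γ : Matrix (Fin n) (Fin n) ℂ) (i : Fin n) :
    matAct n γ (X (Sum.inr i)) = ∑ j, (starRingEnd ℂ) (γ⁻¹ i j) • X (Sum.inr j) := by
  simp [matAct]

theorem matAct_one : matAct n 1 = AlgHom.id ℂ (Rn n) := by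
  ext1 (i | i)
  · simp [matAct_X_inl, Matrix.one_apply]
  · simp [matAct_X_inr, Matrix.one_apply, apply_ite (starRingEnd ℂ)]

theorem matAct_mul (γ δ : Matrix (Fin n) (Fin n) ℂ) :
    matAct n (γ * δ) = (matAct n γ).comp (matAct n δ) := by
  ext1 (i | i)
  · simp only [matAct_X_inl, AlgHom.comp_apply, map_sum, map_smul, Matrix.mul_inv_rev,
      Matrix.mul_apply, Finset.sum_smul, Finset.smul_sum, smul_smul]
    exact Finset.sum_comm
  · simp only [matAct_X_inr, AlgHom.comp_apply, map_sum, map_smul, Matrix.mul_inv_rev,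
      Matrix.mul_apply, Finset.sum_smul, Finset.smul_sum, smul_smul, map_mul]
    exact Finset.sum_comm

theorem matAct_mem_Ppq (γ : Matrix (Fin n) (Fin n) ℂ) {P : Rn n} (hP : P ∈ Ppq n p q) :
    matAct n γ P ∈ Ppq n p q := by
  refine IsWeightedHomogeneous.aeval (w := wt n) ?_ hP
  rintro (i | i)
  · refine IsWeightedHomogeneous.sum _ _ _ fun j _ => ?_
    rw [smul_eq_C_mul]
    exact (isWeightedHomogeneous_X ℂ (wt n) (Sum.inl j)).C_mul _
  · refine IsWeightedHomogeneous.sum _ _ _ fun j _ => ?_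
    rw [smul_eq_C_mul]
    exact (isWeightedHomogeneous_X ℂ (wt n) (Sum.inr j)).C_mul _

theorem pderiv_inl_matAct (γ : Matrix (Fin n) (Fin n) ℂ) (j : Fin n) (P : Rn n) :
    pderiv (Sum.inl j) (matAct n γ P) =
      ∑ i, γ⁻¹ i j • matAct n γ (pderiv (Sum.inl i) P) := by
  rw [matAct, pderiv_aeval]
  simp [pderiv_X, Pi.single_apply]

theorem pderiv_inr_matAct (γ : Matrix (Fin n) (Fin n) ℂ) (j : Fin n) (P : Rn n) :
    pderiv (Sum.inr j) (matAct n γ P) =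
      ∑ i, (starRingEnd ℂ) (γ⁻¹ i j) • matAct n γ (pderiv (Sum.inr i) P) := by
  rw [matAct, pderiv_aeval]
  simp [pderiv_X, Pi.single_apply]

/-- The Laplacian commutes with the action of unitary matrices. -/
theorem DeltaOp_matAct (γ : Matrix.unitaryGroup (Fin n) ℂ) (P : Rn n) :
    DeltaOp n (matAct n γ P) = matAct n γ (DeltaOp n P) := by
  have key : ∀ i k : Fin n, ∑ j, (starRingEnd ℂ) ((γ : Matrix (Fin n) (Fin n) ℂ)⁻¹ i j) *
      (γ : Matrix (Fin n) (Fin n) ℂ)⁻¹ k j = if k = i then 1 else 0 := by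
    intro i k
    have hγ : (γ : Matrix (Fin n) (Fin n) ℂ)⁻¹ = star (γ : Matrix (Fin n) (Fin n) ℂ) :=
      Matrix.inv_eq_left_inv (Unitary.coe_star_mul_self γ)
    have h := congrFun₂ (Unitary.coe_star_mul_self γ) k i
    rw [Matrix.mul_apply, Matrix.one_apply] at h
    rw [hγ, ← h]
    exact Finset.sum_congr rfl fun j _ => by simp [Matrix.star_apply, mul_comm]
  have hsum : ∀ i, ∑ j, ∑ k, ((starRingEnd ℂ) ((γ : Matrix (Fin n) (Fin n) ℂ)⁻¹ i j) *
      (γ : Matrix (Fin n) (Fin n) ℂ)⁻¹ k j) •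
        matAct n γ (pderiv (Sum.inl k) (pderiv (Sum.inr i) P)) =
      matAct n γ (pderiv (Sum.inl i) (pderiv (Sum.inr i) P)) := by
    intro i
    rw [Finset.sum_comm]
    simp [← Finset.sum_smul, key]
  simp only [DeltaOp, LinearMap.sum_apply, LinearMap.comp_apply, Derivation.coeFn_coe,
    pderiv_inr_matAct, map_sum, map_smul, pderiv_inl_matAct, Finset.smul_sum, smul_smul]
  rw [Finset.sum_comm]
  exact Finset.sum_congr rfl fun i _ => hsum i

theorem mem_Hpq {P : Rn n} : P ∈ Hpq n p q ↔ P ∈ Ppq n p q ∧ DeltaOp n P = 0 := by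
  rw [Hpq, Submodule.mem_inf, LinearMap.mem_ker]

theorem matAct_mem_Hpq (γ : Matrix.unitaryGroup (Fin n) ℂ) {P : Rn n} (hP : P ∈ Hpq n p q) :
    matAct n γ P ∈ Hpq n p q := by
  rw [mem_Hpq] at hP ⊢
  refine ⟨matAct_mem_Ppq (γ : Matrix (Fin n) (Fin n) ℂ) hP.1, ?_⟩
  rw [DeltaOp_matAct, hP.2, map_zero]

instance Hpq.finiteDimensional : FiniteDimensional ℂ (Hpq n p q) := by
  have hle : Hpq n p q ≤ restrictTotalDegree (Fin n ⊕ Fin n) ℂ (p + q) := by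
    intro P hP
    rw [mem_restrictTotalDegree]
    refine Finset.sup_le fun e he => ?_
    have hw := hP.1 (mem_support_iff.mp he)
    rw [Finsupp.weight_apply] at hw
    have h := congrArg (AddMonoidHom.fst ℕ ℕ + AddMonoidHom.snd ℕ ℕ) hw
    rw [map_finsuppSum] at h
    refine (le_of_eq ?_).trans h.le
    refine Finsupp.sum_congr fun i _ => ?_
    rcases i with i | i <;> simp [wt]
  exact Submodule.finiteDimensional_of_le hle

/-- The representation of `U(n)` on the polynomial ring. -/
def unitaryRep (n : ℕ) : Representation ℂ (Matrix.unitaryGroup (Fin n) ℂ) (Rn n) where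
  toFun γ := (matAct n γ).toLinearMap
  map_one' := by simp [matAct_one, Module.End.one_eq_id]
  map_mul' γ δ := by simp [matAct_mul, Module.End.mul_eq_comp, AlgHom.comp_toLinearMap]

/-- The representation of `U(n)` on `ℋ_{p,q}`. -/
def harmonicRep (n p q : ℕ) : Representation ℂ (Matrix.unitaryGroup (Fin n) ℂ) (Hpq n p q) :=
  (unitaryRep n).subrepresentation (Hpq n p q) fun γ _ hP =>
    matAct_mem_Hpq γ hP

theorem dInv_eq_finrank_invariants (Γ : Subgroup (Matrix.unitaryGroup (Fin n) ℂ)) :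
    dInv n p q Γ =
      Module.finrank ℂ (Representation.invariants ((harmonicRep n p q).comp Γ.subtype)) := by
  have h : HpqInv n p q Γ =
      (Representation.invariants ((harmonicRep n p q).comp Γ.subtype)).map
        (Hpq n p q).subtype := by
    ext P
    simp only [HpqInv, fixedBy, Submodule.mem_inf, Submodule.mem_iInf, LinearMap.mem_ker,
      LinearMap.sub_apply, sub_eq_zero, Submodule.mem_map, Representation.mem_invariants]
    constructor
    · rintro ⟨hP, h⟩
      exact ⟨⟨P, hP⟩, fun g => Subtype.ext (h g g.2), rfl⟩
    · rintro ⟨Q, h, rfl⟩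
      exact ⟨Q.2, fun g hg => congrArg Subtype.val (h ⟨g, hg⟩)⟩
  rw [dInv, h]
  exact (Submodule.equivMapOfInjective _ (Hpq n p q).injective_subtype _).finrank_eq.symm

theorem card_inv_mul_sum_character_eq_dInv (Γ : Subgroup (Matrix.unitaryGroup (Fin n) ℂ))
    [Fintype Γ] :
    (Nat.card Γ : ℂ)⁻¹ * ∑ γ : Γ, (harmonicRep n p q).character γ = dInv n p q Γ := by
  have : Invertible (Nat.card Γ : ℂ) :=
    invertibleOfNonzero (Nat.cast_ne_zero.mpr Nat.card_pos.ne')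
  rw [dInv_eq_finrank_invariants]
  exact Representation.card_inv_mul_sum_char_eq_finrank ((harmonicRep n p q).comp Γ.subtype)

/-- **Almost conjugate subgroups give CR isospectral elliptic manifolds.**
If finite subgroups `Γ, Γ'` of `U(d)` acting freely on `S^{2d-1}` are almost conjugate in
`U(d)` (there is a bijection `τ : Γ → Γ'` with `τ(γ)` conjugate to `γ` in `U(d)` for all
`γ`), then `d_Γ(p,q) = d_{Γ'}(p,q)` for all `p, q`; consequently the elliptic CR manifolds
`S^{2d-1}/Γ` and `S^{2d-1}/Γ'` are CR isospectral. -/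
theorem almost_conjugate_implies_CR_isospectral (d : ℕ) (hd : 1 ≤ d)
    (Γ Γ' : Subgroup (Matrix.unitaryGroup (Fin d) ℂ)) [Finite Γ] [Finite Γ']
    (hfree : actsFreely d Γ) (hfree' : actsFreely d Γ')
    (halmost : ∃ τ : Γ ≃ Γ', ∀ γ : Γ,
      ∃ A : Matrix.unitaryGroup (Fin d) ℂ, ((τ γ : Γ') : Matrix.unitaryGroup (Fin d) ℂ)
        = A * (γ : Matrix.unitaryGroup (Fin d) ℂ) * A⁻¹) :
    ∀ p q : ℕ, dInv d p q Γ = dInv d p q Γ' := by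
  intro p q
  obtain ⟨τ, hτ⟩ := halmost
  have := Fintype.ofFinite Γ
  have := Fintype.ofFinite Γ'
  have hsum : ∑ γ : Γ, (harmonicRep d p q).character γ =
      ∑ γ : Γ', (harmonicRep d p q).character γ := by
    refine Fintype.sum_equiv τ _ _ fun γ => ?_
    obtain ⟨A, hA⟩ := hτ γ
    rw [hA, Representation.char_conj]
  rw [← Nat.cast_inj (R := ℂ), ← card_inv_mul_sum_character_eq_dInv,
    ← card_inv_mul_sum_character_eq_dInv, hsum, Nat.card_congr τ]

end
end

section
/- Let k be an odd prime with k ≥ 5 and set n = k − 3. Let s : {1,…,n} → ℤ/kℤ be a tuple such that every s_i is a unit, the s_i are pairwise distinct, and there exists i such that s_i ≠ −s_j for all j. If c is a unit of ℤ/kℤ and σ is a permutation of {1,…,n} such that s_i = c·s_{σ(i)} for all i, then c = 1 and σ is the identity. (Hence the action of S_n × (ℤ/kℤ)^× on this family of tuples is free, and each equivalence class has exactly (k−3)!·(k−1) elements.) -/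
/-- **Freeness of the `S_n × (ℤ/kℤ)^×` action on the family `𝒢(k-3,k)`.**
For an odd prime `k ≥ 5` and `n = k-3`: if `s` is a tuple of pairwise distinct units of
`ℤ/kℤ` such that some `s_i` is not the negative of any `s_j`, and `s_i = c·s_{σ(i)}` for a
unit `c` and a permutation `σ`, then `c = 1` and `σ` is the identity. -/
theorem stabilizer_trivial (k : ℕ) (hk : Nat.Prime k) (hodd : Odd k) (hk5 : 5 ≤ k)
    (s : Fin (k - 3) → ZMod k)
    (hunit : ∀ i, IsUnit (s i)) (hinj : Function.Injective s)
    (hopp : ∃ i, ∀ j, s i ≠ - s j)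
    (c : (ZMod k)ˣ) (σ : Equiv.Perm (Fin (k - 3)))
    (h : ∀ i, s i = (c : ZMod k) * s (σ i)) :
    c = 1 ∧ σ = Equiv.refl (Fin (k - 3)) := by
  have : Fact k.Prime := ⟨hk⟩
  have hprod : ∏ i, s i ≠ 0 := Finset.prod_ne_zero_iff.mpr fun i _ => (hunit i).ne_zero
  have hpow : (c : ZMod k) ^ (k - 3) = 1 := by
    have hcalc : ∏ i, s i = (c : ZMod k) ^ (k - 3) * ∏ i, s i := by
      calc ∏ i, s i = ∏ i, (c : ZMod k) * s (σ i) := Finset.prod_congr rfl fun i _ => h i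
        _ = (c : ZMod k) ^ (k - 3) * ∏ i, s i := by
          rw [Finset.prod_mul_distrib, Equiv.prod_comp σ s]
          simp
    exact mul_right_cancel₀ hprod (by rw [← hcalc, one_mul])
  have hsq : (c : ZMod k) ^ 2 = 1 := by
    have hfermat := ZMod.pow_card_sub_one_eq_one c.ne_zero
    rwa [show k - 1 = k - 3 + 2 by omega, pow_add, hpow, one_mul] at hfermat
  have hc : (c : ZMod k) = 1 := by
    refine (eq_or_eq_neg_of_sq_eq_sq _ 1 (by rw [hsq, one_pow])).resolve_right fun hneg => ?_
    obtain ⟨i, hi⟩ := hopp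
    exact hi (σ i) (by rw [h i, hneg, neg_one_mul])
  refine ⟨Units.ext hc, Equiv.ext fun i => hinj ?_⟩
  rw [Equiv.refl_apply, h i, hc, one_mul]
end

section
/- Let n ≥ 1 and p, q ≥ 1. Then the space 𝒫_{p,q} is the internal direct sum of ℋ_{p,q} and the subspace ρ·𝒫_{p−1,q−1} = { ρ·Q : Q ∈ 𝒫_{p−1,q−1} }, where ρ = z_1·z̄_1 + ⋯ + z_n·z̄_n. That is, ℋ_{p,q} ∩ ρ·𝒫_{p−1,q−1} = {0} and ℋ_{p,q} + ρ·𝒫_{p−1,q−1} = 𝒫_{p,q}. -/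
open MvPolynomial Matrix Complex

noncomputable section

/-- `ρ = z_1 z̄_1 + ⋯ + z_n z̄_n`. -/
def rho (n : ℕ) : Rn n :=
  ∑ i : Fin n, MvPolynomial.X (Sum.inl i) * MvPolynomial.X (Sum.inr i)

lemma DeltaOp_apply (n : ℕ) (P : Rn n) :
    DeltaOp n P = ∑ j : Fin n, pderiv (Sum.inl j) (pderiv (Sum.inr j) P) := by
  simp [DeltaOp]

lemma rho_mem_Ppq (n : ℕ) : rho n ∈ Ppq n 1 1 :=
  IsWeightedHomogeneous.sum _ _ _ fun j _ =>
    (isWeightedHomogeneous_X ℂ (wt n) (Sum.inl j)).mul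
      (isWeightedHomogeneous_X ℂ (wt n) (Sum.inr j))

lemma rho_mul_mem_Ppq {n p q : ℕ} {P : Rn n} (hP : P ∈ Ppq n p q) :
    rho n * P ∈ Ppq n (p + 1) (q + 1) := by
  have h := IsWeightedHomogeneous.mul (rho_mem_Ppq n) hP
  rwa [Prod.mk_add_mk, add_comm 1 p, add_comm 1 q] at h

lemma DeltaOp_mem_Ppq {n p q : ℕ} {P : Rn n} (hP : P ∈ Ppq n (p + 1) (q + 1)) :
    DeltaOp n P ∈ Ppq n p q := by
  rw [DeltaOp_apply]
  refine Submodule.sum_mem _ fun j _ => ?_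
  have h : IsWeightedHomogeneous (wt n) (pderiv (Sum.inr j) P) (p + 1, q) :=
    IsWeightedHomogeneous.pderiv hP (by simp [wt])
  exact IsWeightedHomogeneous.pderiv h (by simp [wt])

lemma DeltaOp_eq_zero_of_mem_Ppq {n p q : ℕ} (hpq : p = 0 ∨ q = 0) {P : Rn n}
    (hP : P ∈ Ppq n p q) : DeltaOp n P = 0 := by
  rw [DeltaOp_apply]
  refine Finset.sum_eq_zero fun j _ => ?_
  ext m
  rw [coeff_pderiv, coeff_pderiv, IsWeightedHomogeneous.coeff_eq_zero hP, zero_mul, zero_mul,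
    coeff_zero]
  intro h
  simp only [map_add, Finsupp.weight_single, wt, Sum.elim_inl, Sum.elim_inr, Prod.ext_iff,
    Prod.fst_add, Prod.snd_add, one_smul] at h
  omega

lemma isHomogeneous_of_mem_Ppq {n p q : ℕ} {P : Rn n} (hP : P ∈ Ppq n p q) :
    P.IsHomogeneous (p + q) := by
  intro d hd
  have h := congrArg (fun x : ℕ × ℕ => x.1 + x.2) (hP hd)
  simp only [Finsupp.weight_apply, Finsupp.sum_fintype, zero_smul, implies_true, wt,
    Fintype.sum_sum_type, Sum.elim_inl, Sum.elim_inr, Prod.smul_mk, Prod.fst_add, Prod.snd_add,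
    Prod.fst_sum, Prod.snd_sum, Pi.one_apply, smul_eq_mul, mul_one, mul_zero,
    Finset.sum_const_zero, add_zero, zero_add] at h ⊢
  exact h

lemma pderiv_inl_rho (n : ℕ) (j : Fin n) : pderiv (Sum.inl j) (rho n) = X (Sum.inr j) := by
  simp [rho, pderiv_X, Pi.single_apply]

lemma pderiv_inr_rho (n : ℕ) (j : Fin n) : pderiv (Sum.inr j) (rho n) = X (Sum.inl j) := by
  simp [rho, pderiv_X, Pi.single_apply]

/-- The commutation relation `Δρ = ρΔ + (n + p + q)` on `𝒫_{p,q}`. -/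
lemma DeltaOp_rho_mul {n p q : ℕ} {P : Rn n} (hP : P ∈ Ppq n p q) :
    DeltaOp n (rho n * P) = rho n * DeltaOp n P + (n + p + q) • P := by
  have euler := (isHomogeneous_of_mem_Ppq hP).sum_X_mul_pderiv
  rw [Fintype.sum_sum_type] at euler
  have key (j : Fin n) : pderiv (Sum.inl j) (pderiv (Sum.inr j) (rho n * P)) =
      rho n * pderiv (Sum.inl j) (pderiv (Sum.inr j) P) + P +
        (X (Sum.inl j) * pderiv (Sum.inl j) P + X (Sum.inr j) * pderiv (Sum.inr j) P) := by
    rw [pderiv_mul, pderiv_inr_rho, map_add, pderiv_mul, pderiv_mul, pderiv_inl_rho,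
      pderiv_X_self]
    ring
  simp only [DeltaOp_apply, key, Finset.sum_add_distrib, euler, Finset.mul_sum,
    Finset.sum_const, Finset.card_univ, Fintype.card_fin, add_assoc, add_smul]

/-- For `c > 0` the operator `ρΔ + c` is bijective on `𝒫_{p,q}`. -/
lemma existsUnique_rho_mul_DeltaOp_add_smul {n p q c : ℕ} (hc : 0 < c) {F : Rn n}
    (hF : F ∈ Ppq n p q) :
    ∃! G : Rn n, G ∈ Ppq n p q ∧ rho n * DeltaOp n G + c • G = F := by
  have hc' : (c : ℂ) ≠ 0 := Nat.cast_ne_zero.2 hc.ne'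
  simp only [← Nat.cast_smul_eq_nsmul ℂ]
  by_cases hpq : p = 0 ∨ q = 0
  · refine ⟨(c : ℂ)⁻¹ • F, ⟨Submodule.smul_mem _ _ hF, ?_⟩, ?_⟩
    · rw [DeltaOp_eq_zero_of_mem_Ppq hpq (Submodule.smul_mem _ _ hF), mul_zero, zero_add,
        smul_inv_smul₀ hc']
    · rintro G ⟨hG, rfl⟩
      rw [DeltaOp_eq_zero_of_mem_Ppq hpq hG, mul_zero, zero_add, inv_smul_smul₀ hc']
  · obtain ⟨p, rfl⟩ := Nat.exists_eq_succ_of_ne_zero (not_or.1 hpq).1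
    obtain ⟨q, rfl⟩ := Nat.exists_eq_succ_of_ne_zero (not_or.1 hpq).2
    obtain ⟨H, ⟨hH, hHF⟩, huniq⟩ := existsUnique_rho_mul_DeltaOp_add_smul
      (c := n + p + q + c) (by omega) (DeltaOp_mem_Ppq hF)
    rw [add_smul, ← add_assoc, ← DeltaOp_rho_mul hH, ← Nat.cast_smul_eq_nsmul ℂ] at hHF
    have hG : (c : ℂ)⁻¹ • (F - rho n * H) ∈ Ppq n (p + 1) (q + 1) :=
      Submodule.smul_mem _ _ (Submodule.sub_mem _ hF (rho_mul_mem_Ppq hH))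
    refine ⟨_, ⟨hG, ?_⟩, ?_⟩
    · rw [map_smul, map_sub, ← hHF, add_sub_cancel_left, inv_smul_smul₀ hc', smul_inv_smul₀ hc',
        add_sub_cancel]
    · rintro G ⟨hG', rfl⟩
      have h : DeltaOp n G = H := by
        refine huniq _ ⟨DeltaOp_mem_Ppq hG', ?_⟩
        rw [add_smul, ← add_assoc, ← DeltaOp_rho_mul (DeltaOp_mem_Ppq hG'), map_add, map_smul,
          Nat.cast_smul_eq_nsmul]
      rw [h, add_sub_cancel_left, inv_smul_smul₀ hc']
termination_by p

/-- For `n ≥ 1` the operator `Δρ` is bijective on `𝒫_{p,q}`. -/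
lemma existsUnique_DeltaOp_rho_mul {n p q : ℕ} (hn : 1 ≤ n) {F : Rn n} (hF : F ∈ Ppq n p q) :
    ∃! G : Rn n, G ∈ Ppq n p q ∧ DeltaOp n (rho n * G) = F := by
  obtain ⟨G, ⟨hG, hGF⟩, huniq⟩ :=
    existsUnique_rho_mul_DeltaOp_add_smul (c := n + p + q) (by omega) hF
  refine ⟨G, ⟨hG, (DeltaOp_rho_mul hG).trans hGF⟩, ?_⟩
  rintro K ⟨hK, hKF⟩
  exact huniq K ⟨hK, (DeltaOp_rho_mul hK).symm.trans hKF⟩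

/-- **The decomposition `𝒫_{p,q} = ℋ_{p,q} ⊕ ρ·𝒫_{p-1,q-1}`** for `p, q ≥ 1`. -/
theorem Ppq_direct_sum_decomposition (n p q : ℕ) (hn : 1 ≤ n) (hp : 1 ≤ p) (hq : 1 ≤ q) :
    Hpq n p q ⊓ Submodule.map (LinearMap.mulLeft ℂ (rho n)) (Ppq n (p - 1) (q - 1)) = ⊥ ∧
    Hpq n p q ⊔ Submodule.map (LinearMap.mulLeft ℂ (rho n)) (Ppq n (p - 1) (q - 1))
      = Ppq n p q := by
  obtain ⟨p, rfl⟩ := Nat.exists_eq_add_of_le' hp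
  obtain ⟨q, rfl⟩ := Nat.exists_eq_add_of_le' hq
  simp only [Nat.add_sub_cancel]
  constructor
  · rw [eq_bot_iff]
    rintro _ ⟨⟨-, hker⟩, Q, hQ, rfl⟩
    have hQ0 : Q = 0 := (existsUnique_DeltaOp_rho_mul hn (Submodule.zero_mem _)).unique
      ⟨hQ, hker⟩ ⟨Submodule.zero_mem _, by rw [mul_zero, map_zero]⟩
    simp [hQ0]
  · refine le_antisymm (sup_le inf_le_left ?_) fun P hP => ?_
    · rintro _ ⟨Q, hQ, rfl⟩
      exact rho_mul_mem_Ppq hQ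
    · obtain ⟨Q, ⟨hQ, hQP⟩, -⟩ := existsUnique_DeltaOp_rho_mul hn (DeltaOp_mem_Ppq hP)
      refine Submodule.mem_sup.2 ⟨P - rho n * Q, ⟨?_, ?_⟩, rho n * Q, ⟨Q, hQ, rfl⟩,
        sub_add_cancel _ _⟩
      · exact Submodule.sub_mem _ hP (rho_mul_mem_Ppq hQ)
      · rw [SetLike.mem_coe, LinearMap.mem_ker, map_sub, hQP, sub_self]

end
end
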